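/- The metric g determined by the real constants a, b, p, q, s has identically zero scalar curvature: τ = Σ_{j,l} g^{jl} ρ_{jl} = 0 at every point of ℝ⁴. -/

import Mathlib

noncomputable section

open scoped BigOperators

/-- The metric of a four-dimensional two-symmetric Lorentzian manifold, in
coordinates `x 0 = x¹, x 1 = x², x 2 = x³, x 3 = x⁴`:
`g₁₄ = g₄₁ = g₂₂ = g₃₃ = 1`,
`g₄₄ = x⁴(a(x²)² + b(x³)²) + p(x²)² + 2q x²x³ + s(x³)²`, all others zero. -/
def gmat (a b p q s : ℝ) (x : Fin 4 → ℝ) : Matrix (Fin 4) (Fin 4) ℝ :=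
  Matrix.of fun i j =>
    if i = 0 ∧ j = 3 then 1
    else if i = 3 ∧ j = 0 then 1
    else if i = 1 ∧ j = 1 then 1
    else if i = 2 ∧ j = 2 then 1
    else if i = 3 ∧ j = 3 then
      x 3 * (a * (x 1) ^ 2 + b * (x 2) ^ 2) + p * (x 1) ^ 2
        + 2 * q * x 1 * x 2 + s * (x 2) ^ 2
    else 0

/-- The inverse matrix `g^{ij}`. -/
def ginv (a b p q s : ℝ) (x : Fin 4 → ℝ) : Matrix (Fin 4) (Fin 4) ℝ :=
  (gmat a b p q s x)⁻¹

/-- Partial derivative `∂_i` of a function on ℝ⁴. -/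
def pd (i : Fin 4) (f : (Fin 4 → ℝ) → ℝ) (x : Fin 4 → ℝ) : ℝ :=
  fderiv ℝ f x (Pi.single i 1)

/-- Christoffel symbols `Γ^k_{ij} = (1/2) Σ_l g^{kl}(∂_i g_{jl} + ∂_j g_{il} − ∂_l g_{ij})`. -/
def Gam (a b p q s : ℝ) (k i j : Fin 4) (x : Fin 4 → ℝ) : ℝ :=
  (1 / 2) * ∑ l, ginv a b p q s x k l *
    (pd i (fun y => gmat a b p q s y j l) x
      + pd j (fun y => gmat a b p q s y i l) x
      - pd l (fun y => gmat a b p q s y i j) x)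

/-- Curvature tensor
`R^i_{jkl} = ∂_k Γ^i_{lj} − ∂_l Γ^i_{kj} + Σ_m (Γ^i_{km} Γ^m_{lj} − Γ^i_{lm} Γ^m_{kj})`. -/
def Riem (a b p q s : ℝ) (i j k l : Fin 4) (x : Fin 4 → ℝ) : ℝ :=
  pd k (Gam a b p q s i l j) x - pd l (Gam a b p q s i k j) x
    + ∑ m, (Gam a b p q s i k m x * Gam a b p q s m l j x
      - Gam a b p q s i l m x * Gam a b p q s m k j x)

/-- Ricci tensor `ρ_{jl} = Σ_i R^i_{jil}`. -/
def Ric (a b p q s : ℝ) (j l : Fin 4) (x : Fin 4 → ℝ) : ℝ :=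
  ∑ i, Riem a b p q s i j i l x

/-- The component `g₄₄` of the metric. -/
def gLast (a b p q s : ℝ) (x : Fin 4 → ℝ) : ℝ :=
  x 3 * (a * (x 1) ^ 2 + b * (x 2) ^ 2) + p * (x 1) ^ 2
    + 2 * q * x 1 * x 2 + s * (x 2) ^ 2

lemma pd_const (i : Fin 4) (c : ℝ) (x : Fin 4 → ℝ) : pd i (fun _ => c) x = 0 := by
  simp [pd]

lemma ginv_eq (a b p q s : ℝ) (x : Fin 4 → ℝ) :
    ginv a b p q s x =
      !![-gLast a b p q s x, 0, 0, 1; 0, 1, 0, 0; 0, 0, 1, 0; 1, 0, 0, 0] := by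
  refine Matrix.inv_eq_right_inv ?_
  ext i j
  fin_cases i <;> fin_cases j <;> simp [gmat, gLast, Matrix.mul_apply, Fin.sum_univ_four]
  ring

lemma pd_zero_gLast (a b p q s : ℝ) (x : Fin 4 → ℝ) : pd 0 (gLast a b p q s) x = 0 := by
  have hd : DifferentiableAt ℝ (gLast a b p q s) x := by
    unfold gLast
    fun_prop
  rw [pd, ← hd.lineDeriv_eq_fderiv]
  simp [lineDeriv, gLast]

lemma pd_gmat (a b p q s : ℝ) (m i j : Fin 4) (x : Fin 4 → ℝ) :
    pd m (fun y => gmat a b p q s y i j) x =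
      if i = 3 ∧ j = 3 then pd m (gLast a b p q s) x else 0 := by
  fin_cases i <;> fin_cases j <;> simp [gmat, pd_const]
  rfl

/-- The only possibly nonzero Christoffel symbols are `Γ¹_{i4} = Γ¹_{4i} = ∂_i g₄₄ / 2` and
`Γ²₄₄ = -∂₂ g₄₄ / 2`, `Γ³₄₄ = -∂₃ g₄₄ / 2`. -/
lemma Gam_eq (a b p q s : ℝ) (k i j : Fin 4) :
    Gam a b p q s k i j = fun x =>
      if k = 0 then
        if j = 3 then pd i (gLast a b p q s) x / 2
        else if i = 3 then pd j (gLast a b p q s) x / 2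
        else 0
      else if (k = 1 ∨ k = 2) ∧ i = 3 ∧ j = 3 then -pd k (gLast a b p q s) x / 2
      else 0 := by
  funext x
  fin_cases k <;> fin_cases i <;> fin_cases j <;>
    simp [Gam, ginv_eq, pd_gmat, Fin.sum_univ_four, pd_zero_gLast] <;> ring

lemma ginv_mul_Ric (a b p q s : ℝ) (j l : Fin 4) (x : Fin 4 → ℝ) :
    ginv a b p q s x j l * Ric a b p q s j l x = 0 := by
  fin_cases j <;> fin_cases l <;>
    simp [ginv_eq, Ric, Riem, Gam_eq, Fin.sum_univ_four, pd_const, pd_zero_gLast]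

/-- the scalar curvature `τ = Σ_{j,l} g^{jl} ρ_{jl}` vanishes identically. -/
theorem scalar_curvature_zero (a b p q s : ℝ) (x : Fin 4 → ℝ) :
    ∑ j, ∑ l, ginv a b p q s x j l * Ric a b p q s j l x = 0 := by
  exact Finset.sum_eq_zero fun j _ => Finset.sum_eq_zero fun l _ => ginv_mul_Ric a b p q s j l x
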